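/- Let (A,+,·) be a left brace. Then λ_{a+b} = λ_a ∘ λ_b for all a,b ∈ A if and only if λ_{λ_a(b)} = λ_b for all a,b ∈ A. -/

import Mathlib

/-- `λ_a(b) = -a + a·b` for a left-brace multiplication `mul`. -/
def braceLam {A : Type*} [AddCommGroup A] (mul : A → A → A) (a b : A) : A :=
  -a + mul a b

/-- The star operation `a * b = λ_a(b) - b`. -/
def braceStar {A : Type*} [AddCommGroup A] (mul : A → A → A) (a b : A) : A :=
  braceLam mul a b - b

theorem add_braceLam {A : Type*} [AddCommGroup A] (mul : A → A → A) (a b : A) :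
    a + braceLam mul a b = mul a b := by
  simp [braceLam]

/-- The map `a ↦ λ_a` is multiplicative: `λ_{a·b} = λ_a ∘ λ_b`. -/
theorem braceLam_mul {A : Type*} [AddCommGroup A] (mul : A → A → A)
    (hassoc : ∀ a b c : A, mul (mul a b) c = mul a (mul b c))
    (hdist : ∀ a b c : A, mul a (b + c) = mul a b - a + mul a c) (a b c : A) :
    braceLam mul (mul a b) c = braceLam mul a (braceLam mul b c) := by
  have h := hdist a b (braceLam mul b c)
  rw [add_braceLam, ← hassoc] at h
  rw [braceLam, h, braceLam.eq_1 mul a]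
  abel

theorem braceLam_injective {A : Type*} [AddCommGroup A] (mul : A → A → A)
    (hassoc : ∀ a b c : A, mul (mul a b) c = mul a (mul b c))
    (hzl : ∀ a : A, mul 0 a = a)
    (hinv : ∀ a : A, ∃ b : A, mul a b = 0 ∧ mul b a = 0) (a : A) :
    Function.Injective (braceLam mul a) := by
  intro x y h
  obtain ⟨d, -, hd⟩ := hinv a
  have h' : mul a x = mul a y := add_left_cancel h
  rw [← hzl x, ← hzl y, ← hd, hassoc, hassoc, h']

theorem braceLam_surjective {A : Type*} [AddCommGroup A] (mul : A → A → A)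
    (hassoc : ∀ a b c : A, mul (mul a b) c = mul a (mul b c))
    (hzl : ∀ a : A, mul 0 a = a)
    (hinv : ∀ a : A, ∃ b : A, mul a b = 0 ∧ mul b a = 0) (a : A) :
    Function.Surjective (braceLam mul a) := by
  intro b
  obtain ⟨d, hd, -⟩ := hinv a
  exact ⟨mul d (a + b), by rw [braceLam, ← hassoc, hd, hzl, neg_add_cancel_left]⟩

/-- For a left brace `A`, `λ_{a+b} = λ_a ∘ λ_b` for all `a, b ∈ A` iff
`λ_{λ_a(b)} = λ_b` for all `a, b ∈ A`. -/
theorem stmt2 {A : Type*} [AddCommGroup A]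
    (mul : A → A → A)
    (hassoc : ∀ a b c : A, mul (mul a b) c = mul a (mul b c))
    (hzl : ∀ a : A, mul 0 a = a)
    (hzr : ∀ a : A, mul a 0 = a)
    (hinv : ∀ a : A, ∃ b : A, mul a b = 0 ∧ mul b a = 0)
    (hdist : ∀ a b c : A, mul a (b + c) = mul a b - a + mul a c)
    :
    (∀ a b c : A, braceLam mul (a + b) c = braceLam mul a (braceLam mul b c)) ↔
      (∀ a b c : A, braceLam mul (braceLam mul a b) c = braceLam mul b c) := by
  constructor
  · intro h a b c
    apply braceLam_injective mul hassoc hzl hinv a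
    rw [← h, add_braceLam, braceLam_mul mul hassoc hdist]
  · intro h a b c
    obtain ⟨b, rfl⟩ := braceLam_surjective mul hassoc hzl hinv a b
    rw [add_braceLam, braceLam_mul mul hassoc hdist, h]
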